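/- arXiv:2102.04243 — 3 statements merged into one kernel-verified Lean document; each statement's English description precedes it below -/
import Mathlib

section
/- The function ψ is infinitely differentiable on ℝ, and for every k ∈ ℕ and every x ∈ ℝ its k-th derivative is given by differentiation under the integral sign: ψ^(k)(x) = ((√(2κ)/σ)^k / Γ(ρ/κ)) ∫₀^∞ t^(ρ/κ−1+k) exp(−t²/2 + ((x−ζ)√(2κ)/σ)·t) dt. -/
open Real MeasureTheory

lemma integrableOn_rpow_mul_exp_neg_sq_div_two_add_mul {s : ℝ} (hs : -1 < s) (y : ℝ) :
    IntegrableOn (fun t : ℝ => t ^ s * Real.exp (-t ^ 2 / 2 + y * t)) (Set.Ioi 0) := by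
  have h := (integrableOn_rpow_mul_exp_neg_mul_sq (b := 1 / 4) (by norm_num) hs).const_mul
    (Real.exp (y ^ 2))
  refine Integrable.mono' h (by fun_prop) ?_
  filter_upwards [ae_restrict_mem measurableSet_Ioi] with t ht
  have ht0 : 0 ≤ t ^ s := Real.rpow_nonneg (le_of_lt ht) s
  rw [Real.norm_of_nonneg (by positivity), mul_left_comm, ← Real.exp_add]
  refine mul_le_mul_of_nonneg_left (Real.exp_le_exp.2 ?_) ht0
  nlinarith [sq_nonneg (t / 2 - y)]

lemma hasDerivAt_integral_rpow_mul_exp_neg_sq_div_two_add_mul {s : ℝ} (hs : -1 < s) (y : ℝ) :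
    HasDerivAt (fun y : ℝ => ∫ t in Set.Ioi (0 : ℝ), t ^ s * Real.exp (-t ^ 2 / 2 + y * t))
      (∫ t in Set.Ioi (0 : ℝ), t ^ (s + 1) * Real.exp (-t ^ 2 / 2 + y * t)) y := by
  refine (hasDerivAt_integral_of_dominated_loc_of_deriv_le
    (F := fun y t => t ^ s * Real.exp (-t ^ 2 / 2 + y * t))
    (F' := fun y t => t ^ (s + 1) * Real.exp (-t ^ 2 / 2 + y * t))
    (bound := fun t => t ^ (s + 1) * Real.exp (-t ^ 2 / 2 + (y + 1) * t))
    (Iio_mem_nhds (lt_add_one y)) (Filter.Eventually.of_forall fun _ => by fun_prop)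
    (integrableOn_rpow_mul_exp_neg_sq_div_two_add_mul hs y) (by fun_prop) ?_
    (integrableOn_rpow_mul_exp_neg_sq_div_two_add_mul (by linarith) (y + 1)) ?_).2
  · filter_upwards [ae_restrict_mem measurableSet_Ioi] with t ht z hz
    have ht' : 0 < t := ht
    have hz' : z ≤ y + 1 := le_of_lt hz
    rw [Real.norm_of_nonneg (by positivity)]
    gcongr
  · filter_upwards [ae_restrict_mem measurableSet_Ioi] with t ht z _
    have h := ((((hasDerivAt_id z).mul_const t).const_add (-t ^ 2 / 2)).exp).const_mul (t ^ s)
    refine h.congr_deriv ?_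
    rw [Real.rpow_add_one (ne_of_gt ht)]
    simp only [id_eq]
    ring

/-- `ψ` is infinitely differentiable, and all its derivatives are obtained by
differentiation under the integral sign. -/
theorem psi_smooth_iteratedDeriv
    (κ σ ρ ζ : ℝ) (hκ : 0 < κ) (hσ : 0 < σ) (hρ : 0 < ρ)
    (ψ : ℝ → ℝ)
    (hψ : ∀ x : ℝ, ψ x = (Real.Gamma (ρ / κ))⁻¹ *
      ∫ t in Set.Ioi (0 : ℝ), t ^ (ρ / κ - 1) *
        Real.exp (-t ^ 2 / 2 + ((x - ζ) * Real.sqrt (2 * κ) / σ) * t)) :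
    ContDiff ℝ (⊤ : ℕ∞) ψ ∧
    ∀ (k : ℕ) (x : ℝ), iteratedDeriv k ψ x =
      ((Real.sqrt (2 * κ) / σ) ^ k / Real.Gamma (ρ / κ)) *
        ∫ t in Set.Ioi (0 : ℝ), t ^ (ρ / κ - 1 + k) *
          Real.exp (-t ^ 2 / 2 + ((x - ζ) * Real.sqrt (2 * κ) / σ) * t) := by
  have hpos : 0 < ρ / κ := div_pos hρ hκ
  have hderiv (k : ℕ) (x : ℝ) : HasDerivAt
      (fun x => ((Real.sqrt (2 * κ) / σ) ^ k / Real.Gamma (ρ / κ)) *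
        ∫ t in Set.Ioi (0 : ℝ), t ^ (ρ / κ - 1 + k) *
          Real.exp (-t ^ 2 / 2 + ((x - ζ) * Real.sqrt (2 * κ) / σ) * t))
      (((Real.sqrt (2 * κ) / σ) ^ (k + 1) / Real.Gamma (ρ / κ)) *
        ∫ t in Set.Ioi (0 : ℝ), t ^ (ρ / κ - 1 + (k + 1 : ℕ)) *
          Real.exp (-t ^ 2 / 2 + ((x - ζ) * Real.sqrt (2 * κ) / σ) * t)) x := by
    have hs : -1 < ρ / κ - 1 + k := by
      have : (0 : ℝ) ≤ k := k.cast_nonneg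
      linarith
    have hinner : HasDerivAt (fun x => (x - ζ) * Real.sqrt (2 * κ) / σ)
        (1 * Real.sqrt (2 * κ) / σ) x :=
      (((hasDerivAt_id x).sub_const ζ).mul_const _).div_const σ
    have h := ((hasDerivAt_integral_rpow_mul_exp_neg_sq_div_two_add_mul hs
      ((x - ζ) * Real.sqrt (2 * κ) / σ)).comp x hinner).const_mul
        ((Real.sqrt (2 * κ) / σ) ^ k / Real.Gamma (ρ / κ))
    refine h.congr_deriv ?_
    rw [Nat.cast_succ, ← add_assoc]
    ring
  have hiter (k : ℕ) : iteratedDeriv k ψ = fun x =>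
      ((Real.sqrt (2 * κ) / σ) ^ k / Real.Gamma (ρ / κ)) *
        ∫ t in Set.Ioi (0 : ℝ), t ^ (ρ / κ - 1 + k) *
          Real.exp (-t ^ 2 / 2 + ((x - ζ) * Real.sqrt (2 * κ) / σ) * t) := by
    induction k with
    | zero =>
      funext x
      simp [hψ x]
    | succ k ih =>
      rw [iteratedDeriv_succ, ih]
      exact funext fun x => (hderiv k x).deriv
  refine ⟨contDiff_of_differentiable_iteratedDeriv fun k _ => ?_, fun k => congrFun (hiter k)⟩
  rw [hiter k]
  exact fun x => (hderiv k x).differentiableAt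
end

section
/- The function x ↦ ψ(x)/ψ'(x) is well defined (ψ'(x) ≠ 0 for all x) and strictly decreasing on ℝ; equivalently, its derivative (ψ'(x)² − ψ''(x)ψ(x))/ψ'(x)² is strictly negative for every x ∈ ℝ. -/
open Real MeasureTheory

/-- The Laplace-type integral `∫₀^∞ t^(a-1) exp(-t²/2 + y t) dt`. -/
noncomputable def gaussianMellin (a y : ℝ) : ℝ :=
  ∫ t in Set.Ioi (0 : ℝ), t ^ (a - 1) * Real.exp (-t ^ 2 / 2 + y * t)

theorem exp_quadratic_le {y R : ℝ} (hy : |y| ≤ R) (t : ℝ) :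
    Real.exp (-t ^ 2 / 2 + y * t) ≤ Real.exp (R ^ 2) * Real.exp (-(1 / 4) * t ^ 2) := by
  rw [← Real.exp_add]
  apply Real.exp_le_exp.mpr
  have h : y ^ 2 ≤ R ^ 2 := sq_le_sq' (abs_le.mp hy).1 (abs_le.mp hy).2
  nlinarith [sq_nonneg (t / 2 - y)]

theorem aestronglyMeasurable_gaussianMellin_integrand (a y : ℝ) :
    AEStronglyMeasurable (fun t : ℝ => t ^ (a - 1) * Real.exp (-t ^ 2 / 2 + y * t))
      (volume.restrict (Set.Ioi 0)) :=
  Measurable.aestronglyMeasurable (by fun_prop)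

theorem integrableOn_gaussianMellin_bound {a : ℝ} (ha : 0 < a) (R : ℝ) :
    IntegrableOn (fun t : ℝ => Real.exp (R ^ 2) * (t ^ (a - 1) * Real.exp (-(1 / 4) * t ^ 2)))
      (Set.Ioi 0) :=
  (integrableOn_rpow_mul_exp_neg_mul_sq (by norm_num) (by linarith)).const_mul _

theorem gaussianMellin_integrand_norm_le (a : ℝ) {y R : ℝ} (hy : |y| ≤ R) {t : ℝ} (ht : 0 < t) :
    ‖t ^ (a - 1) * Real.exp (-t ^ 2 / 2 + y * t)‖ ≤
      Real.exp (R ^ 2) * (t ^ (a - 1) * Real.exp (-(1 / 4) * t ^ 2)) := by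
  rw [Real.norm_of_nonneg (by positivity), mul_left_comm]
  exact mul_le_mul_of_nonneg_left (exp_quadratic_le hy t) (by positivity)

theorem integrableOn_gaussianMellin {a : ℝ} (ha : 0 < a) (y : ℝ) :
    IntegrableOn (fun t : ℝ => t ^ (a - 1) * Real.exp (-t ^ 2 / 2 + y * t)) (Set.Ioi 0) := by
  refine Integrable.mono' (integrableOn_gaussianMellin_bound ha |y|)
    (aestronglyMeasurable_gaussianMellin_integrand a y) ?_
  filter_upwards [ae_restrict_mem measurableSet_Ioi] with t ht
  exact gaussianMellin_integrand_norm_le a le_rfl ht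

theorem gaussianMellin_pos {a : ℝ} (ha : 0 < a) (y : ℝ) : 0 < gaussianMellin a y := by
  refine (setIntegral_pos_iff_support_of_nonneg_ae ?_ (integrableOn_gaussianMellin ha y)).mpr ?_
  · filter_upwards [ae_restrict_mem measurableSet_Ioi] with t ht
    have ht : 0 < t := ht
    simp only [Pi.zero_apply]
    positivity
  · have hsub : Set.Ioi (0 : ℝ) ⊆
        Function.support (fun t : ℝ => t ^ (a - 1) * Real.exp (-t ^ 2 / 2 + y * t)) ∩
          Set.Ioi 0 := by
      intro t ht
      have ht' : 0 < t := ht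
      exact ⟨by rw [Function.mem_support]; positivity, ht⟩
    exact lt_of_lt_of_le (by simp) (measure_mono hsub)

theorem hasDerivAt_gaussianMellin {a : ℝ} (ha : 0 < a) (y : ℝ) :
    HasDerivAt (gaussianMellin a) (gaussianMellin (a + 1) y) y := by
  refine (hasDerivAt_integral_of_dominated_loc_of_deriv_le
    (μ := volume.restrict (Set.Ioi 0))
    (F := fun y t : ℝ => t ^ (a - 1) * Real.exp (-t ^ 2 / 2 + y * t))
    (F' := fun y t : ℝ => t ^ (a + 1 - 1) * Real.exp (-t ^ 2 / 2 + y * t))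
    (bound := fun t => Real.exp ((|y| + 1) ^ 2) *
      (t ^ (a + 1 - 1) * Real.exp (-(1 / 4) * t ^ 2)))
    (Metric.ball_mem_nhds y one_pos)
    (Filter.Eventually.of_forall fun z => aestronglyMeasurable_gaussianMellin_integrand a z)
    (integrableOn_gaussianMellin ha y)
    (aestronglyMeasurable_gaussianMellin_integrand (a + 1) y) ?_
    (integrableOn_gaussianMellin_bound (by linarith) _) ?_).2
  · filter_upwards [ae_restrict_mem measurableSet_Ioi] with t ht z hz
    refine gaussianMellin_integrand_norm_le (a + 1) ?_ ht
    rw [Metric.mem_ball, Real.dist_eq] at hz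
    linarith [abs_sub_abs_le_abs_sub z y]
  · filter_upwards [ae_restrict_mem measurableSet_Ioi] with t ht z _
    have ht : 0 < t := ht
    have h : HasDerivAt (fun z : ℝ => -t ^ 2 / 2 + z * t) t z := by
      simpa using ((hasDerivAt_id z).mul_const t).const_add (-t ^ 2 / 2)
    refine (h.exp.const_mul (t ^ (a - 1))).congr_deriv ?_
    rw [show a + 1 - 1 = a - 1 + 1 by ring, Real.rpow_add_one ht.ne']
    ring

/-- Strict log-convexity of `a ↦ gaussianMellin a y` along unit steps, from the strict
Cauchy–Schwarz inequality. -/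
theorem gaussianMellin_sq_lt {a : ℝ} (ha : 0 < a) (y : ℝ) :
    gaussianMellin (a + 1) y ^ 2 < gaussianMellin (a + 1 + 1) y * gaussianMellin a y := by
  have h0 := gaussianMellin_pos ha y
  set m : ℝ := gaussianMellin (a + 1) y / gaussianMellin a y with hm
  have i0 := integrableOn_gaussianMellin ha y
  have i1 := integrableOn_gaussianMellin (a := a + 1) (by linarith) y
  have i2 := integrableOn_gaussianMellin (a := a + 1 + 1) (by linarith) y
  have hexpand : ∀ t ∈ Set.Ioi (0 : ℝ),
      t ^ (a + 1 + 1 - 1) * Real.exp (-t ^ 2 / 2 + y * t)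
        - 2 * m * (t ^ (a + 1 - 1) * Real.exp (-t ^ 2 / 2 + y * t))
        + m ^ 2 * (t ^ (a - 1) * Real.exp (-t ^ 2 / 2 + y * t))
      = (t - m) ^ 2 * (t ^ (a - 1) * Real.exp (-t ^ 2 / 2 + y * t)) := by
    intro t ht
    have ht : 0 < t := ht
    rw [show a + 1 + 1 - 1 = a - 1 + 1 + 1 by ring, show a + 1 - 1 = a - 1 + 1 by ring,
      Real.rpow_add_one ht.ne', Real.rpow_add_one ht.ne']
    ring
  have i21 : IntegrableOn (fun t : ℝ => t ^ (a + 1 + 1 - 1) * Real.exp (-t ^ 2 / 2 + y * t)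
      - 2 * m * (t ^ (a + 1 - 1) * Real.exp (-t ^ 2 / 2 + y * t))) (Set.Ioi 0) :=
    i2.sub (i1.const_mul (2 * m))
  have hcomb := i21.add (i0.const_mul (m ^ 2))
  have hpos : 0 < ∫ t in Set.Ioi (0 : ℝ),
      (t - m) ^ 2 * (t ^ (a - 1) * Real.exp (-t ^ 2 / 2 + y * t)) := by
    refine (setIntegral_pos_iff_support_of_nonneg_ae ?_
      (IntegrableOn.congr_fun hcomb hexpand measurableSet_Ioi)).mpr ?_
    · filter_upwards [ae_restrict_mem measurableSet_Ioi] with t ht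
      have ht : 0 < t := ht
      simp only [Pi.zero_apply]
      positivity
    · have hsub : Set.Ioi |m| ⊆ Function.support
          (fun t : ℝ => (t - m) ^ 2 * (t ^ (a - 1) * Real.exp (-t ^ 2 / 2 + y * t))) ∩
            Set.Ioi 0 := by
        intro t ht
        have ht' : |m| < t := ht
        have hmt : 0 < t - m := sub_pos.mpr ((le_abs_self m).trans_lt ht')
        have ht0 : 0 < t := (abs_nonneg m).trans_lt ht'
        exact ⟨by rw [Function.mem_support]; positivity, ht0⟩
      exact lt_of_lt_of_le (by simp) (measure_mono hsub)
  rw [← setIntegral_congr_fun measurableSet_Ioi hexpand,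
    integral_add i21 (i0.const_mul _),
    integral_sub i2 (i1.const_mul _), integral_const_mul, integral_const_mul] at hpos
  change 0 < gaussianMellin (a + 1 + 1) y - 2 * m * gaussianMellin (a + 1) y
    + m ^ 2 * gaussianMellin a y at hpos
  have hm' : gaussianMellin (a + 1) y = m * gaussianMellin a y := by
    rw [hm]; field_simp
  rw [hm'] at hpos ⊢
  nlinarith [mul_pos hpos h0]

/-- The function `x ↦ ψ(x)/ψ'(x)` is well defined (`ψ' ≠ 0`) and strictly
decreasing; equivalently its derivative `(ψ'² − ψ''ψ)/ψ'²` is strictly negative. -/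
theorem psi_ratio_strictAnti
    (κ σ ρ ζ : ℝ) (hκ : 0 < κ) (hσ : 0 < σ) (hρ : 0 < ρ)
    (ψ : ℝ → ℝ)
    (hψ : ∀ x : ℝ, ψ x = (Real.Gamma (ρ / κ))⁻¹ *
      ∫ t in Set.Ioi (0 : ℝ), t ^ (ρ / κ - 1) *
        Real.exp (-t ^ 2 / 2 + ((x - ζ) * Real.sqrt (2 * κ) / σ) * t)) :
    (∀ x : ℝ, deriv ψ x ≠ 0) ∧
    StrictAnti (fun x : ℝ => ψ x / deriv ψ x) ∧
    (∀ x : ℝ,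
      ((deriv ψ x) ^ 2 - iteratedDeriv 2 ψ x * ψ x) / (deriv ψ x) ^ 2 < 0) := by
  have ha : 0 < ρ / κ := div_pos hρ hκ
  set a : ℝ := ρ / κ
  set C : ℝ := (Real.Gamma a)⁻¹
  have hC : 0 < C := inv_pos.mpr (Real.Gamma_pos_of_pos ha)
  set b : ℝ := Real.sqrt (2 * κ) / σ with hb
  have hb0 : 0 < b := by positivity
  let Y : ℝ → ℝ := fun x => (x - ζ) * Real.sqrt (2 * κ) / σ
  have hY : ∀ x, HasDerivAt Y b x := fun x => by
    simpa [Y, hb] using (((hasDerivAt_id x).sub_const ζ).mul_const (Real.sqrt (2 * κ))).div_const σ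
  have hψ0 : ψ = fun x => C * gaussianMellin a (Y x) := funext hψ
  have hd1 : ∀ x, HasDerivAt ψ (C * (gaussianMellin (a + 1) (Y x) * b)) x := fun x => by
    rw [hψ0]
    exact ((hasDerivAt_gaussianMellin ha (Y x)).comp x (hY x)).const_mul C
  have hψ1 : deriv ψ = fun x => C * (gaussianMellin (a + 1) (Y x) * b) :=
    funext fun x => (hd1 x).deriv
  have hd2 : ∀ x, HasDerivAt (deriv ψ) (C * (gaussianMellin (a + 1 + 1) (Y x) * b * b)) x :=
    fun x => by
      rw [hψ1]
      exact (((hasDerivAt_gaussianMellin (by linarith) (Y x)).comp x (hY x)).mul_const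
        b).const_mul C
  have hpos : ∀ x, 0 < deriv ψ x := fun x => by
    rw [hψ1]
    have := gaussianMellin_pos (a := a + 1) (by linarith) (Y x)
    positivity
  have hψ2 : ∀ x, iteratedDeriv 2 ψ x = deriv (deriv ψ) x := fun x => by
    rw [iteratedDeriv_succ, iteratedDeriv_one]
  have hneg : ∀ x, ((deriv ψ x) ^ 2 - iteratedDeriv 2 ψ x * ψ x) / (deriv ψ x) ^ 2 < 0 := by
    intro x
    refine div_neg_of_neg_of_pos ?_ (pow_pos (hpos x) 2)
    rw [hψ2, (hd2 x).deriv, (hd1 x).deriv, hψ0]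
    have h := mul_lt_mul_of_pos_left (gaussianMellin_sq_lt ha (Y x))
      (show 0 < (C * b) ^ 2 by positivity)
    linarith
  refine ⟨fun x => (hpos x).ne', strictAnti_of_deriv_neg fun x => ?_, hneg⟩
  have h := ((hd1 x).differentiableAt.hasDerivAt.div (hd2 x).differentiableAt.hasDerivAt
    (hpos x).ne').deriv
  have hx := hneg x
  rw [hψ2] at hx
  change deriv (ψ / deriv ψ) x < 0
  rw [h]
  convert hx using 2
  ring
end

section
/- The function ψ satisfies lim_{x→−∞} ψ(x) = 0 and lim_{x→+∞} ψ(x) = +∞. -/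
open Real MeasureTheory

/-- The integrand `t ^ (a - 1) * exp (-t ^ 2 / 2 + c * t)` is integrable on `(0, ∞)` for `a > 0`. -/
lemma integrableOn_rpow_mul_exp_neg_sq_add {a : ℝ} (ha : 0 < a) (c : ℝ) :
    IntegrableOn (fun t : ℝ => t ^ (a - 1) * Real.exp (-t ^ 2 / 2 + c * t)) (Set.Ioi 0) := by
  have hint := (integrableOn_rpow_mul_exp_neg_mul_sq (b := 1 / 4) (by norm_num)
    (s := a - 1) (by linarith)).const_mul (Real.exp (c ^ 2))
  refine Integrable.mono' hint (by fun_prop) ?_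
  filter_upwards [ae_restrict_mem measurableSet_Ioi] with t ht
  have ht0 : (0 : ℝ) < t := ht
  have hp : 0 ≤ t ^ (a - 1) := Real.rpow_nonneg ht0.le _
  rw [Real.norm_of_nonneg (by positivity), mul_left_comm, ← Real.exp_add]
  refine mul_le_mul_of_nonneg_left (Real.exp_le_exp.mpr ?_) hp
  nlinarith [sq_nonneg (t / 2 - c)]

lemma tendsto_integral_rpow_mul_exp_neg_sq_add_atBot {a : ℝ} (ha : 0 < a) :
    Filter.Tendsto (fun c : ℝ => ∫ t in Set.Ioi (0 : ℝ),
      t ^ (a - 1) * Real.exp (-t ^ 2 / 2 + c * t)) Filter.atBot (nhds 0) := by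
  have hlim : ∀ᵐ t ∂(volume.restrict (Set.Ioi (0 : ℝ))), Filter.Tendsto
      (fun c : ℝ => t ^ (a - 1) * Real.exp (-t ^ 2 / 2 + c * t)) Filter.atBot (nhds 0) := by
    filter_upwards [ae_restrict_mem measurableSet_Ioi] with t ht
    have hexp := Real.tendsto_exp_atBot.comp (Filter.tendsto_atBot_add_const_left Filter.atBot
      (-t ^ 2 / 2) (Filter.tendsto_id.atBot_mul_const (show (0 : ℝ) < t from ht)))
    simpa using hexp.const_mul (t ^ (a - 1))
  simpa using tendsto_integral_filter_of_dominated_convergence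
    (fun t : ℝ => t ^ (a - 1) * Real.exp (-t ^ 2 / 2 + 0 * t))
    (Filter.Eventually.of_forall fun c =>
      (integrableOn_rpow_mul_exp_neg_sq_add ha c).aestronglyMeasurable)
    (by
      filter_upwards [Filter.eventually_le_atBot (0 : ℝ)] with c hc
      filter_upwards [ae_restrict_mem measurableSet_Ioi] with t ht
      have ht0 : (0 : ℝ) < t := ht
      have hp : 0 ≤ t ^ (a - 1) := Real.rpow_nonneg ht0.le _
      rw [Real.norm_of_nonneg (by positivity)]
      gcongr)
    (integrableOn_rpow_mul_exp_neg_sq_add ha 0) hlim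

lemma tendsto_integral_rpow_mul_exp_neg_sq_add_atTop {a : ℝ} (ha : 0 < a) :
    Filter.Tendsto (fun c : ℝ => ∫ t in Set.Ioi (0 : ℝ),
      t ^ (a - 1) * Real.exp (-t ^ 2 / 2 + c * t)) Filter.atTop Filter.atTop := by
  have hpos : 0 < ∫ t in Set.Ioi (0 : ℝ), t ^ a * Real.exp (-(1 / 2) * t ^ (2 : ℝ)) := by
    rw [integral_rpow_mul_exp_neg_mul_rpow two_pos (by linarith) (by norm_num)]
    have hΓ := Real.Gamma_pos_of_pos (show 0 < (a + 1) / 2 by linarith)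
    positivity
  refine Filter.tendsto_atTop_mono (fun c => ?_) (Filter.tendsto_id.atTop_mul_const hpos)
  rw [id, ← integral_const_mul]
  refine setIntegral_mono_on ?_ (integrableOn_rpow_mul_exp_neg_sq_add ha c) measurableSet_Ioi ?_
  · exact (integrableOn_rpow_mul_exp_neg_mul_rpow (by linarith) two_pos (by norm_num)).const_mul c
  · intro t ht
    have ht0 : (0 : ℝ) < t := ht
    have hp : 0 ≤ t ^ (a - 1) := Real.rpow_nonneg ht0.le _
    have hsplit : t ^ a = t ^ (a - 1) * t := by
      rw [← Real.rpow_add_one ht0.ne', sub_add_cancel]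
    have hsq : -(1 / 2) * t ^ (2 : ℝ) = -t ^ 2 / 2 := by
      rw [Real.rpow_two]; ring
    have hle : c * t ≤ Real.exp (c * t) := by linarith [Real.add_one_le_exp (c * t)]
    calc c * (t ^ a * Real.exp (-(1 / 2) * t ^ (2 : ℝ)))
        = t ^ (a - 1) * (Real.exp (-t ^ 2 / 2) * (c * t)) := by rw [hsplit, hsq]; ring
      _ ≤ t ^ (a - 1) * (Real.exp (-t ^ 2 / 2) * Real.exp (c * t)) := by gcongr
      _ = t ^ (a - 1) * Real.exp (-t ^ 2 / 2 + c * t) := by rw [Real.exp_add]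

/-- `ψ(x) → 0` as `x → −∞` and `ψ(x) → +∞` as `x → +∞`. -/
theorem psi_limits
    (κ σ ρ ζ : ℝ) (hκ : 0 < κ) (hσ : 0 < σ) (hρ : 0 < ρ)
    (ψ : ℝ → ℝ)
    (hψ : ∀ x : ℝ, ψ x = (Real.Gamma (ρ / κ))⁻¹ *
      ∫ t in Set.Ioi (0 : ℝ), t ^ (ρ / κ - 1) *
        Real.exp (-t ^ 2 / 2 + ((x - ζ) * Real.sqrt (2 * κ) / σ) * t)) :
    Filter.Tendsto ψ Filter.atBot (nhds 0) ∧
    Filter.Tendsto ψ Filter.atTop Filter.atTop := by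
  have ha : 0 < ρ / κ := div_pos hρ hκ
  have hΓ : 0 < (Real.Gamma (ρ / κ))⁻¹ := inv_pos.mpr (Real.Gamma_pos_of_pos ha)
  have hs : 0 < Real.sqrt (2 * κ) := Real.sqrt_pos.mpr (by positivity)
  rw [funext hψ]
  constructor
  · have hc : Filter.Tendsto (fun x : ℝ => (x - ζ) * Real.sqrt (2 * κ) / σ)
        Filter.atBot Filter.atBot :=
      ((Filter.tendsto_atBot_add_const_right _ (-ζ) Filter.tendsto_id).atBot_mul_const
        hs).atBot_div_const hσ
    simpa using ((tendsto_integral_rpow_mul_exp_neg_sq_add_atBot ha).comp hc).const_mul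
      (Real.Gamma (ρ / κ))⁻¹
  · have hc : Filter.Tendsto (fun x : ℝ => (x - ζ) * Real.sqrt (2 * κ) / σ)
        Filter.atTop Filter.atTop :=
      ((Filter.tendsto_atTop_add_const_right _ (-ζ) Filter.tendsto_id).atTop_mul_const
        hs).atTop_div_const hσ
    exact ((tendsto_integral_rpow_mul_exp_neg_sq_add_atTop ha).comp hc).const_mul_atTop hΓ
end
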